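/- arXiv:2603.20001 — 4 statements merged into one kernel-verified Lean document; each statement's English description precedes it below -/
import Mathlib

section
/- Let Σ_F and Σ_V be state spaces, each with a partial, commutative, associative operation ⊕, and let R be a binary relation between Σ_F and Σ_V satisfying the extension property: if R φ Φ and φ₀ = φ ⊕ φ₁ then there exists Φ₁ with R φ₁ Φ₁, Φ ⊕ Φ₁ defined, and R φ₀ (Φ ⊕ Φ₁). Then for all A, B ⊆ Σ_V with B well-formed, btr(A) * btr(B) ⊆ btr(A * B). -/
/-- Separating conjunction of two sets of states w.r.t. a partial operation. -/
def star {σ : Type*} (op : σ → σ → Option σ) (A B : Set σ) : Set σ :=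
  {ω | ∃ ω₁ ∈ A, ∃ ω₂ ∈ B, op ω₁ ω₂ = some ω}

/-- Backward translation of an IVL assertion along a state encoding relation. -/
def rbtr {σF σV : Type*} (R : σF → σV → Prop) (P : Set σV) : Set σF :=
  {ω | ∃ Ω ∈ P, R ω Ω}

/-- An IVL assertion is well-formed w.r.t. the state encoding relation. -/
def WellFormed {σF σV : Type*} (R : σF → σV → Prop) (P : Set σV) : Prop :=
  rbtr R P = {ω | ∀ Ω, R ω Ω → Ω ∈ P}

/-- First direction of the generalized Lemma 3.4 (Section 3.6):
btr(A) * btr(B) ⊆ btr(A * B) for well-formed B, assuming the extension property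
of the state encoding relation. -/
theorem stmt5 {σF σV : Type*}
    (opF : σF → σF → Option σF) (opV : σV → σV → Option σV)
    (commF : ∀ a b, opF a b = opF b a)
    (assocF : ∀ a b c, (opF a b).bind (fun x => opF x c) = (opF b c).bind (fun x => opF a x))
    (commV : ∀ a b, opV a b = opV b a)
    (assocV : ∀ a b c, (opV a b).bind (fun x => opV x c) = (opV b c).bind (fun x => opV a x))
    (R : σF → σV → Prop)
    -- extension property:
    (hext : ∀ φ Φ φ₀ φ₁, R φ Φ → opF φ φ₁ = some φ₀ →
      ∃ Φ₁ ΦΦ₁, R φ₁ Φ₁ ∧ opV Φ Φ₁ = some ΦΦ₁ ∧ R φ₀ ΦΦ₁)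
    (A B : Set σV) (hB : WellFormed R B) :
    star opF (rbtr R A) (rbtr R B) ⊆ rbtr R (star opV A B) := by
  rintro ω ⟨ω₁, ⟨Ω₁, hA, hR⟩, ω₂, h₂, hop⟩
  obtain ⟨Ω₂, Ω, hR₂, hopV, hRΩ⟩ := hext ω₁ Ω₁ ω ω₂ hR hop
  rw [hB] at h₂
  exact ⟨Ω, ⟨Ω₁, hA, Ω₂, h₂ Ω₂ hR₂, hopV⟩, hRΩ⟩
end

section
/- Let R be a binary relation between state spaces Σ_F and Σ_V that is total on Σ_F (for every φ there exists Φ with R φ Φ). If a set T ⊆ Σ_V relationally preserves the semantics of some A₀ ⊆ Σ_F, i.e. for all ω, Ω with R ω Ω one has ω ∈ A₀ ↔ Ω ∈ T, then T is well-formed: btr(T) = {ω | ∀Ω, R ω Ω → Ω ∈ T}. -/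
/-- Section 3.6 of the paper: if a relation R is total on the front-end states and
T relationally preserves the semantics of some front-end assertion A₀, then T is
well-formed: rbtr(T) = {ω | ∀ Ω, R ω Ω → Ω ∈ T}. -/
theorem stmt6 {σF σV : Type*} (R : σF → σV → Prop)
    (htot : ∀ φ, ∃ Φ, R φ Φ)
    (A₀ : Set σF) (T : Set σV)
    (hsem : ∀ ω Ω, R ω Ω → (ω ∈ A₀ ↔ Ω ∈ T)) :
    rbtr R T = {ω | ∀ Ω, R ω Ω → Ω ∈ T} := by
  ext ω
  constructor
  · rintro ⟨Ω, hΩ, hR⟩ Ω' hR'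
    exact (hsem ω Ω' hR').1 ((hsem ω Ω hR).2 hΩ)
  · intro h
    obtain ⟨Ω, hR⟩ := htot ω
    exact ⟨Ω, h Ω hR, hR⟩
end

section
/- Let Σ_F and Σ_V be state spaces, each with a partial, commutative, associative operation ⊕, and let R be a binary relation between Σ_F and Σ_V that is total on Σ_F (for every φ there exists Φ with R φ Φ). Suppose A ⊆ Σ_V is monotone, B₀ ⊆ Σ_F has generalized backward satisfiability w.r.t. T_B ⊆ Σ_V, and T_B relationally preserves the semantics of B₀ (for all ω, Ω with R ω Ω: ω ∈ B₀ ↔ Ω ∈ T_B). Then btr(A * T_B) ⊆ btr(A) * btr(T_B). -/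
/-- a ≽ b : there exists r with b ⊕ r defined and equal to a. -/
def geq {σ : Type*} (op : σ → σ → Option σ) (a b : σ) : Prop := ∃ r, op b r = some a

/-- A set of states is monotone if it is upward closed w.r.t. ≽. -/
def Mono {σ : Type*} (op : σ → σ → Option σ) (A : Set σ) : Prop :=
  ∀ ω ∈ A, ∀ ω', geq op ω' ω → ω' ∈ A

/-- Generalized backward satisfiability (Definition 3.9 of the paper). -/
def GenBSat {σF σV : Type*} (opF : σF → σF → Option σF) (opV : σV → σV → Option σV)
    (R : σF → σV → Prop) (B₀ : Set σF) (T : Set σV) : Prop :=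
  ∀ ω Ω ΩA ΩF, R ω Ω → opV ΩA ΩF = some Ω → ΩA ∈ T →
    ∃ ωA ωF ΩF', opF ωA ωF = some ω ∧ ωA ∈ B₀ ∧ R ωF ΩF' ∧ geq opV ΩF' ΩF

/-- Second direction of the generalized Lemma 3.4 (Section 3.6):
btr(A * T_B) ⊆ btr(A) * btr(T_B). -/
theorem stmt7 {σF σV : Type*}
    (opF : σF → σF → Option σF) (opV : σV → σV → Option σV)
    (commF : ∀ a b, opF a b = opF b a)
    (assocF : ∀ a b c, (opF a b).bind (fun x => opF x c) = (opF b c).bind (fun x => opF a x))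
    (commV : ∀ a b, opV a b = opV b a)
    (assocV : ∀ a b c, (opV a b).bind (fun x => opV x c) = (opV b c).bind (fun x => opV a x))
    (R : σF → σV → Prop)
    (htot : ∀ φ, ∃ Φ, R φ Φ)
    (A : Set σV) (hAmono : Mono opV A)
    (B₀ : Set σF) (TB : Set σV)
    (hbsat : GenBSat opF opV R B₀ TB)
    (hsem : ∀ ω Ω, R ω Ω → (ω ∈ B₀ ↔ Ω ∈ TB)) :
    rbtr R (star opV A TB) ⊆ star opF (rbtr R A) (rbtr R TB) := by
  rintro ω ⟨Ω, ⟨ΩF, hΩF, ΩA, hΩA, hop⟩, hR⟩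
  obtain ⟨ωA, ωF, ΩF', hω, hωA, hRF, hge⟩ := hbsat ω Ω ΩA ΩF hR (commV ΩA ΩF ▸ hop) hΩA
  obtain ⟨Φ, hΦ⟩ := htot ωA
  exact ⟨ωF, ⟨ΩF', hAmono ΩF hΩF ΩF' hge, hRF⟩, ωA, ⟨Φ, (hsem ωA Φ hΦ).mp hωA, hΦ⟩,
    commF ωF ωA ▸ hω⟩
end

section
/- Real permission footprints for the two magic wands P₁ and P₂ exist but rational ones do not: let S₁ := {v : ℚ | 0 < v ∧ v^2 ≤ 1/2} and S₂ := {v : ℚ | 0 < v ∧ v < 1 ∧ (1 − v)^2 ≥ 1/2}. Then: (a) there exist real numbers r₁, r₂ with r₁ + r₂ ≤ 1 such that (v : ℝ) ≤ r₁ for every v ∈ S₁ and (v : ℝ) ≤ r₂ for every v ∈ S₂; but (b) there do not exist rational numbers q₁, q₂ with q₁ + q₂ ≤ 1 such that v ≤ q₁ for every v ∈ S₁ and v ≤ q₂ for every v ∈ S₂. -/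
/-- The set of possible permission amounts demanded by the wand P₁ of Figure 6. -/
def S₁ : Set ℚ := {v | 0 < v ∧ v ^ 2 ≤ 1 / 2}

/-- The set of possible permission amounts demanded by the wand P₂ of Figure 6. -/
def S₂ : Set ℚ := {v | 0 < v ∧ v < 1 ∧ (1 - v) ^ 2 ≥ 1 / 2}

theorem sq_sqrt_two_div_two : (√2 / 2 : ℝ) ^ 2 = 1 / 2 := by
  rw [div_pow, Real.sq_sqrt zero_le_two]
  norm_num

theorem le_sqrt_two_div_two_of_mem_S₁ {v : ℚ} (hv : v ∈ S₁) : (v : ℝ) ≤ √2 / 2 := by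
  refine abs_le_of_sq_le_sq' ?_ (by positivity) |>.2
  rw [sq_sqrt_two_div_two]
  have hv2 := hv.2
  rify at hv2
  exact hv2

theorem le_one_sub_sqrt_two_div_two_of_mem_S₂ {v : ℚ} (hv : v ∈ S₂) :
    (v : ℝ) ≤ 1 - √2 / 2 := by
  obtain ⟨-, hv1, hv2⟩ := hv
  have hv1' : (0 : ℝ) ≤ 1 - v := sub_nonneg.2 (by exact_mod_cast hv1.le)
  rify at hv2
  rw [← sq_sqrt_two_div_two] at hv2
  linarith [(abs_le_of_sq_le_sq' hv2 hv1').2]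

theorem sqrt_two_div_two_le_of_forall_mem_S₁ {q : ℚ} (hq : ∀ v ∈ S₁, v ≤ q) :
    √2 / 2 ≤ (q : ℝ) := by
  by_contra! h
  obtain ⟨v, hqv, hv⟩ := exists_rat_btwn h
  have hqv : q < v := by exact_mod_cast hqv
  have hv0 : 0 < v := by linarith [hq (1 / 2) ⟨by norm_num, by norm_num⟩]
  have hv0' : (0 : ℝ) ≤ v := by exact_mod_cast hv0.le
  have hv2 : (v : ℝ) ^ 2 ≤ 1 / 2 := sq_sqrt_two_div_two ▸ pow_le_pow_left₀ hv0' hv.le 2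
  exact hqv.not_ge (hq v ⟨hv0, by rify; exact hv2⟩)

theorem one_sub_sqrt_two_div_two_le_of_forall_mem_S₂ {q : ℚ} (hq : ∀ v ∈ S₂, v ≤ q) :
    1 - √2 / 2 ≤ (q : ℝ) := by
  by_contra! h
  obtain ⟨v, hqv, hv⟩ := exists_rat_btwn h
  have hqv : q < v := by exact_mod_cast hqv
  have hv0 : 0 < v := by linarith [hq (1 / 4) ⟨by norm_num, by norm_num, by norm_num⟩]
  have hc : (0 : ℝ) < √2 / 2 := by positivity
  have hv1 : (v : ℝ) < 1 := by linarith
  have hv2 : (1 / 2 : ℝ) ≤ (1 - v) ^ 2 :=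
    sq_sqrt_two_div_two ▸ pow_le_pow_left₀ hc.le (by linarith) 2
  exact hqv.not_ge (hq v ⟨hv0, by exact_mod_cast hv1, by rify; exact hv2⟩)

/-- The number-theoretic core of Figure 6 of the paper: real permission footprints
for the two magic wands exist, but rational ones do not. -/
theorem stmt17 :
    -- (a) real footprints exist:
    (∃ r₁ r₂ : ℝ, r₁ + r₂ ≤ 1 ∧ (∀ v ∈ S₁, (v : ℝ) ≤ r₁) ∧ (∀ v ∈ S₂, (v : ℝ) ≤ r₂)) ∧
    -- (b) rational footprints do not:
    ¬ (∃ q₁ q₂ : ℚ, q₁ + q₂ ≤ 1 ∧ (∀ v ∈ S₁, v ≤ q₁) ∧ (∀ v ∈ S₂, v ≤ q₂)) := by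
  refine ⟨⟨√2 / 2, 1 - √2 / 2, by linarith, fun v => le_sqrt_two_div_two_of_mem_S₁,
    fun v => le_one_sub_sqrt_two_div_two_of_mem_S₂⟩, ?_⟩
  rintro ⟨q₁, q₂, hq, h₁, h₂⟩
  have hq' : (q₁ : ℝ) + q₂ ≤ 1 := by exact_mod_cast hq
  have h₁' := sqrt_two_div_two_le_of_forall_mem_S₁ h₁
  have h₂' := one_sub_sqrt_two_div_two_le_of_forall_mem_S₂ h₂
  refine irrational_sqrt_two ⟨2 * q₁, ?_⟩
  push_cast
  linarith
end
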